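/- Let a : ℝ × ℝ^n → ℝ^n be continuous, let φ : ℝ × ℝ^n → ℝ be continuously differentiable, and let X : [0,T] → ℝ × ℝ^n be differentiable with X'(s) = (1, a(X(s))) for all s ∈ [0,T]. Then ∫₀^T |φ(X(s))|² ds ≤ 2 T |φ(X(0))|² + 2 T² ∫₀^T |𝒢φ(X(τ))|² dτ, where 𝒢φ = ∂_t φ + a · ∇_Y φ. -/

import Mathlib

open MeasureTheory Set RealInnerProductSpace

/-- The transport operator `𝒢φ(X) = ∂_t φ(X) + a(X) · ∇_Y φ(X)` for
`X = (t, Y) ∈ ℝ × ℝⁿ`. -/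
noncomputable def transportOp {n : ℕ}
    (a : ℝ × EuclideanSpace ℝ (Fin n) → EuclideanSpace ℝ (Fin n))
    (φ : ℝ × EuclideanSpace ℝ (Fin n) → ℝ)
    (X : ℝ × EuclideanSpace ℝ (Fin n)) : ℝ :=
  deriv (fun t => φ (t, X.2)) X.1 + ⟪a X, gradient (fun Y => φ (X.1, Y)) X.2⟫

theorem transportOp_eq_fderiv {n : ℕ}
    (a : ℝ × EuclideanSpace ℝ (Fin n) → EuclideanSpace ℝ (Fin n))
    (φ : ℝ × EuclideanSpace ℝ (Fin n) → ℝ) (hφ : ContDiff ℝ 1 φ)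
    (x : ℝ × EuclideanSpace ℝ (Fin n)) :
    transportOp a φ x = fderiv ℝ φ x (1, a x) := by
  have hd : HasFDerivAt φ (fderiv ℝ φ x) (x.1, x.2) :=
    ((hφ.differentiable (by norm_num)) x).hasFDerivAt
  have h1 : HasDerivAt (fun t => φ (t, x.2)) (fderiv ℝ φ x (1, 0)) x.1 :=
    hd.comp_hasDerivAt x.1 ((hasDerivAt_id x.1).prodMk (hasDerivAt_const x.1 x.2))
  have h2 : HasFDerivAt (fun Y => φ (x.1, Y))
      ((fderiv ℝ φ x).comp (ContinuousLinearMap.inr ℝ ℝ (EuclideanSpace ℝ (Fin n)))) x.2 :=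
    hd.comp x.2 (hasFDerivAt_prodMk_right x.1 x.2)
  unfold transportOp
  rw [h1.deriv, real_inner_comm, gradient, InnerProductSpace.toDual_symm_apply, h2.fderiv]
  simp only [ContinuousLinearMap.comp_apply, ContinuousLinearMap.inr_apply]
  rw [← map_add]
  simp

theorem sq_integral_le (g : ℝ → ℝ) (s : ℝ) (hs : 0 ≤ s) (hg : ContinuousOn g (Icc 0 s)) :
    (∫ τ in (0 : ℝ)..s, g τ) ^ 2 ≤ s * ∫ τ in (0 : ℝ)..s, (g τ) ^ 2 := by
  rcases hs.eq_or_lt with rfl | hs0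
  · simp
  have i1 : IntervalIntegrable g volume 0 s := hg.intervalIntegrable_of_Icc hs
  have i2 : IntervalIntegrable (fun τ => g τ ^ 2) volume 0 s :=
    (hg.pow 2).intervalIntegrable_of_Icc hs
  have key : ∀ c : ℝ, 2 * c * (∫ τ in (0 : ℝ)..s, g τ)
      ≤ (∫ τ in (0 : ℝ)..s, (g τ) ^ 2) + s * c ^ 2 := by
    intro c
    have := intervalIntegral.integral_mono_on (μ := volume) hs (i1.const_mul (2 * c))
      (i2.add (intervalIntegrable_const (c := c ^ 2)))
      (fun x _ => by nlinarith [sq_nonneg (g x - c)])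
    rw [intervalIntegral.integral_const_mul, intervalIntegral.integral_add i2
      intervalIntegrable_const] at this
    simpa using this
  have h := key ((∫ τ in (0 : ℝ)..s, g τ) / s)
  set J := ∫ τ in (0 : ℝ)..s, g τ
  have h3 := mul_le_mul_of_nonneg_left h hs
  have e1 : s * (2 * (J / s) * J) = 2 * J ^ 2 := by field_simp
  have e2 : s * (s * (J / s) ^ 2) = J ^ 2 := by field_simp
  rw [mul_add, e1, e2] at h3
  linarith

/-- Along a characteristic curve `X'(s) = (1, a(X(s)))` on `[0,T]`, a `C¹` function `φ`
satisfies the L² estimate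
`∫₀ᵀ |φ(X(s))|² ds ≤ 2T |φ(X(0))|² + 2T² ∫₀ᵀ |𝒢φ(X(τ))|² dτ`. -/
theorem statement_2 {n : ℕ}
    (a : ℝ × EuclideanSpace ℝ (Fin n) → EuclideanSpace ℝ (Fin n)) (ha : Continuous a)
    (φ : ℝ × EuclideanSpace ℝ (Fin n) → ℝ) (hφ : ContDiff ℝ 1 φ)
    (T : ℝ) (hT : 0 ≤ T) (X : ℝ → ℝ × EuclideanSpace ℝ (Fin n))
    (hX : ∀ s ∈ Set.Icc (0 : ℝ) T, HasDerivAt X ((1 : ℝ), a (X s)) s) :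
    (∫ s in (0 : ℝ)..T, (φ (X s)) ^ 2) ≤
      2 * T * (φ (X 0)) ^ 2 + 2 * T ^ 2 * ∫ τ in (0 : ℝ)..T, (transportOp a φ (X τ)) ^ 2 := by
  have hXc : ContinuousOn X (Icc 0 T) := fun s hs => (hX s hs).continuousAt.continuousWithinAt
  have hd : ∀ s ∈ Icc (0 : ℝ) T, HasDerivAt (fun s => φ (X s)) (transportOp a φ (X s)) s := by
    intro s hs
    rw [transportOp_eq_fderiv a φ hφ]
    exact ((hφ.differentiable (by norm_num)) (X s)).hasFDerivAt.comp_hasDerivAt s (hX s hs)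
  have hGc : Continuous (fun x => transportOp a φ x) := by
    simp_rw [transportOp_eq_fderiv a φ hφ]
    exact (hφ.continuous_fderiv (by norm_num)).clm_apply (continuous_const.prodMk ha)
  have hg : ContinuousOn (fun s => transportOp a φ (X s)) (Icc 0 T) :=
    hGc.comp_continuousOn hXc
  have hf : ContinuousOn (fun s => φ (X s)) (Icc 0 T) := hφ.continuous.comp_continuousOn hXc
  set I := ∫ τ in (0 : ℝ)..T, (transportOp a φ (X τ)) ^ 2 with hI
  have hb : ∀ s ∈ Icc (0 : ℝ) T, (φ (X s)) ^ 2 ≤ 2 * (φ (X 0)) ^ 2 + 2 * T * I := by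
    intro s hs
    have hsub : Icc (0 : ℝ) s ⊆ Icc 0 T := Icc_subset_Icc_right hs.2
    have hgs := hg.mono hsub
    have ftc := intervalIntegral.integral_eq_sub_of_hasDerivAt
      (fun x hx => hd x (hsub (by rwa [uIcc_of_le hs.1] at hx)))
      (hgs.intervalIntegrable_of_Icc hs.1)
    have cs := sq_integral_le _ s hs.1 hgs
    have n1 : 0 ≤ ∫ τ in (0 : ℝ)..s, (transportOp a φ (X τ)) ^ 2 :=
      intervalIntegral.integral_nonneg hs.1 (fun _ _ => sq_nonneg _)
    have mono : (∫ τ in (0 : ℝ)..s, (transportOp a φ (X τ)) ^ 2) ≤ I :=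
      intervalIntegral.integral_mono_interval le_rfl hs.1 hs.2
        (Filter.Eventually.of_forall fun _ => sq_nonneg _)
        ((hg.pow 2).intervalIntegrable_of_Icc hT)
    have m2 := mul_le_mul hs.2 mono n1 hT
    rw [ftc] at cs
    nlinarith [sq_nonneg (φ (X s) - 2 * φ (X 0))]
  have := intervalIntegral.integral_mono_on (μ := volume) hT
    ((hf.pow 2).intervalIntegrable_of_Icc hT) intervalIntegrable_const hb
  rw [intervalIntegral.integral_const, smul_eq_mul, sub_zero] at this
  calc _ ≤ _ := this
    _ = _ := by ring
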